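/- Let ⊥̄ = (⊥,…,⊥) ∈ V^d (which belongs to S₁, hence to the domain of Φ₁). Then the first coordinate of Φ₁(⊥̄) equals the alternating nested fixed point: Φ₁(⊥̄)₁ = μx₁.νx₂.μx₃.νx₄.⋯.μx_{d−1}.νx_d.δ(x₁,…,x_d). -/

import Mathlib

open scoped Classical

/-- `Δ(τ̄)_i = δ(τ₁,…,τ_{i−1},τ_i,τ_i,…,τ_i)` (with 0-based indices, the `j`-th
argument of `δ` is `τ_{min i j}`). -/
def Delta {V : Type*} [CompleteLattice V] {d : ℕ} (δ : (Fin d → V) → V)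
    (τ : Fin d → V) : Fin d → V :=
  fun i => δ (fun j => τ (min i j))

/-- `δ` is chain-continuous: it commutes with suprema and infima of nonempty chains. -/
def ChainContinuous {V : Type*} [CompleteLattice V] {d : ℕ} (δ : (Fin d → V) → V) : Prop :=
  ∀ C : Set (Fin d → V), C.Nonempty → IsChain (· ≤ ·) C →
    δ (sSup C) = sSup (δ '' C) ∧ δ (sInf C) = sInf (δ '' C)

/-- The parity order `1 ≺ 3 ≺ 5 ≺ ⋯ ≺ 6 ≺ 4 ≺ 2` (on positive naturals). -/
def ParityLE (m n : ℕ) : Prop :=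
  (Odd m ∧ Even n) ∨ (Odd m ∧ Odd n ∧ m ≤ n) ∨ (Even m ∧ Even n ∧ n ≤ m)

/-- `τ̄` is ordered: `τ_i ≤ τ_j` whenever `i ⪯ j` in the parity order
(1-based positions). -/
def IsOrdered {V : Type*} [CompleteLattice V] {d : ℕ} (τ : Fin d → V) : Prop :=
  ∀ i j : Fin d, ParityLE (i.val + 1) (j.val + 1) → τ i ≤ τ j

/-- `τ̄` is `n`-fixed: all coordinates at 1-based positions `≥ n` are equal
(to the coordinate at position `n`). -/
def IsNFixed {V : Type*} {d : ℕ} (n : ℕ) (τ : Fin d → V) : Prop :=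
  ∀ i j : Fin d, n ≤ i.val + 1 → n ≤ j.val + 1 → τ i = τ j

/-- `τ̄` is `n`-saturated: `Δ(τ̄)_i = τ_i` for all 1-based positions `i ≤ n − 1`. -/
def IsNSaturated {V : Type*} [CompleteLattice V] {d : ℕ} (δ : (Fin d → V) → V)
    (n : ℕ) (τ : Fin d → V) : Prop :=
  ∀ i : Fin d, i.val + 2 ≤ n → Delta δ τ i = τ i

/-- The set `S_n ⊆ V^d`. -/
def SN {V : Type*} [CompleteLattice V] {d : ℕ} (δ : (Fin d → V) → V) (n : ℕ) :
    Set (Fin d → V) :=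
  {τ | IsOrdered τ ∧ IsNFixed n τ ∧ IsNSaturated δ n τ ∧
    (Odd n → τ ≤ Delta δ τ) ∧ (Even n → Delta δ τ ≤ τ)}

/-- `Bid_n(τ̄)_i = τ_i` for `i ≤ n−1` and `= τ_{n−2}` for `i ≥ n`
(with `τ₋₁ = ⊥`, `τ₀ = ⊤`; 1-based positions). -/
def Bid {V : Type*} [CompleteLattice V] {d : ℕ} (n : ℕ) (τ : Fin d → V) : Fin d → V :=
  fun i =>
    if i.val + 2 ≤ n then τ i
    else if n = 1 then ⊥
    else if n = 2 then ⊤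
    else if h : n - 3 < d then τ ⟨n - 3, h⟩ else ⊥

/-- `Cut_n(τ̄)_i = τ_i` for `i ≤ n−1` and `= τ_{n+1}` for `i ≥ n` (1-based positions). -/
def Cut {V : Type*} [CompleteLattice V] {d : ℕ} (n : ℕ) (τ : Fin d → V) : Fin d → V :=
  fun i =>
    if i.val + 2 ≤ n then τ i
    else if h : n < d then τ ⟨n, h⟩ else ⊥

/-- A partial function `X ⇀ X`, given by a total function together with a domain. -/
structure PFunc (X : Type*) where
  toFun : X → X
  dom : Set X

/-- A total function, seen as a partial function. -/
def PFunc.total {X : Type*} (f : X → X) : PFunc X := ⟨f, Set.univ⟩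

/-- The set of fixed points of a partial function. -/
def PFunc.Fix {X : Type*} (F : PFunc X) : Set X := {x | x ∈ F.dom ∧ F.toFun x = x}

/-- Composition `F;G : x ↦ G(F(x))` of partial functions. -/
def PFunc.comp {X : Type*} (F G : PFunc X) : PFunc X :=
  ⟨fun x => G.toFun (F.toFun x), {x | x ∈ F.dom ∧ F.toFun x ∈ G.dom}⟩

/-- `lim↑F` maps `x` to the least fixed point of `F` that is `≥ x`; its domain is
the set of `x` for which such a least fixed point exists. -/
noncomputable def limUp {X : Type*} [PartialOrder X] (F : PFunc X) : PFunc X where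
  toFun x := if h : ∃ y, IsLeast {z | z ∈ F.Fix ∧ x ≤ z} y then h.choose else x
  dom := {x | ∃ y, IsLeast {z | z ∈ F.Fix ∧ x ≤ z} y}

/-- `lim↓F` maps `x` to the greatest fixed point of `F` that is `≤ x`. -/
noncomputable def limDown {X : Type*} [PartialOrder X] (F : PFunc X) : PFunc X where
  toFun x := if h : ∃ y, IsGreatest {z | z ∈ F.Fix ∧ z ≤ x} y then h.choose else x
  dom := {x | ∃ y, IsGreatest {z | z ∈ F.Fix ∧ z ≤ x} y}

/-- A partial function is monotone (order-preserving on its domain). -/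
def MonotonePF {X : Type*} [Preorder X] (F : PFunc X) : Prop :=
  ∀ x ∈ F.dom, ∀ y ∈ F.dom, x ≤ y → F.toFun x ≤ F.toFun y

/-- `A` is a chain-complete subset: every nonempty chain contained in `A` has a
supremum and an infimum (in `X`) which belong to `A`. -/
def ChainCompleteIn {X : Type*} [Preorder X] (A : Set X) : Prop :=
  ∀ C : Set X, C ⊆ A → C.Nonempty → IsChain (· ≤ ·) C →
    (∃ y ∈ A, IsLUB C y) ∧ (∃ y ∈ A, IsGLB C y)

/-- A monotone partial function `F` is ascending on `A`. -/
def AscendingOn {X : Type*} [Preorder X] (F : PFunc X) (A : Set X) : Prop :=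
  MonotonePF F ∧ A ⊆ F.dom ∧ ChainCompleteIn A ∧ ∀ x ∈ A, F.toFun x ∈ A ∧ x ≤ F.toFun x

/-- A monotone partial function `F` is descending on `A`. -/
def DescendingOn {X : Type*} [Preorder X] (F : PFunc X) (A : Set X) : Prop :=
  MonotonePF F ∧ A ⊆ F.dom ∧ ChainCompleteIn A ∧ ∀ x ∈ A, F.toFun x ∈ A ∧ F.toFun x ≤ x

/-- `PhiAux δ k = Φ_{d−k}`: the formulae `Φ_n`, defined by downward recursion
`Φ_d = Bid_d ; lim↓Δ` and, for `n ≤ d−1`,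
`Φ_n = Bid_n ; lim↑(lim↑Δ ; Φ_{n+1} ; Cut_n)` if `n` is odd, and
`Φ_n = Bid_n ; lim↓(lim↓Δ ; Φ_{n+1} ; Cut_n)` if `n` is even. -/
noncomputable def PhiAux {V : Type*} [CompleteLattice V] {d : ℕ}
    (δ : (Fin d → V) → V) : ℕ → PFunc (Fin d → V)
  | 0 => (PFunc.total (Bid d)).comp (limDown (PFunc.total (Delta δ)))
  | (k + 1) =>
      if Odd (d - (k + 1)) then
        (PFunc.total (Bid (d - (k + 1)))).comp
          (limUp (((limUp (PFunc.total (Delta δ))).comp (PhiAux δ k)).comp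
            (PFunc.total (Cut (d - (k + 1))))))
      else
        (PFunc.total (Bid (d - (k + 1)))).comp
          (limDown (((limDown (PFunc.total (Delta δ))).comp (PhiAux δ k)).comp
            (PFunc.total (Cut (d - (k + 1))))))

/-- The partial function `Φ_n : V^d ⇀ V^d`. -/
noncomputable def Phi {V : Type*} [CompleteLattice V] {d : ℕ}
    (δ : (Fin d → V) → V) (n : ℕ) : PFunc (Fin d → V) :=
  PhiAux δ (d - n)

/-- `μx.f(x)`, the least fixed point of a monotone `f` (Knaster–Tarski). -/
noncomputable def lfpOf {V : Type*} [CompleteLattice V] (f : V → V) : V :=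
  sInf {x | f x ≤ x}

/-- `νx.f(x)`, the greatest fixed point of a monotone `f` (Knaster–Tarski). -/
noncomputable def gfpOf {V : Type*} [CompleteLattice V] (f : V → V) : V :=
  sSup {x | x ≤ f x}

/-- `NestedAux δ k σ = ψ_{d+1−k}(σ)`, where `ψ_{d+1} = δ` and
`ψ_n(x₁,…,x_{n−1}) = μ/ν y_n. ψ_{n+1}(x₁,…,x_{n−1},y_n)` (μ for odd `n`, ν for even `n`).
The partial assignment `σ` gives the value of `x_{j+1}` as `σ j`. -/
noncomputable def NestedAux {V : Type*} [CompleteLattice V] {d : ℕ}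
    (δ : (Fin d → V) → V) : ℕ → (ℕ → V) → V
  | 0, σ => δ (fun i => σ i.val)
  | (k + 1), σ =>
      if Odd (d - k) then
        lfpOf (fun y => NestedAux δ k (fun j => if j = d - k - 1 then y else σ j))
      else
        gfpOf (fun y => NestedAux δ k (fun j => if j = d - k - 1 then y else σ j))

/-- The alternating nested fixed point
`μx₁.νx₂.μx₃.νx₄.⋯.μx_{d−1}.νx_d.δ(x₁,…,x_d)`. -/
noncomputable def Nested {V : Type*} [CompleteLattice V] {d : ℕ}
    (δ : (Fin d → V) → V) : V :=
  NestedAux δ d (fun _ => ⊥)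

/-- `fillS m σ v`: keep the first `m` entries of `σ`, then constantly `v`. -/
def fillS {V : Type*} (m : ℕ) (σ : ℕ → V) (v : V) : ℕ → V :=
  fun j => if j < m then σ j else v

/-- `tupS`: the restriction of `fillS` to `Fin d`. -/
def tupS {V : Type*} (d m : ℕ) (σ : ℕ → V) (v : V) : Fin d → V :=
  fun i => fillS m σ v i.val

/-- Upward invariant. -/
def UpOK {V : Type*} [LE V] (d : ℕ) (ψ : ℕ → (ℕ → V) → V) (m : ℕ) (σ : ℕ → V) (v : V) : Prop :=
  ∀ k, m ≤ k → k ≤ d → v ≤ ψ k (fillS m σ v)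

/-- Downward invariant. -/
def DnOK {V : Type*} [LE V] (d : ℕ) (ψ : ℕ → (ℕ → V) → V) (m : ℕ) (σ : ℕ → V) (v : V) : Prop :=
  ∀ k, m ≤ k → k ≤ d → ψ k (fillS m σ v) ≤ v

/-- Basic properties of a family of nested fixed points. -/
structure PsiFam {V : Type*} [PartialOrder V] {d : ℕ} (δ : (Fin d → V) → V)
    (ψ : ℕ → (ℕ → V) → V) : Prop where
  dmono : Monotone δ
  mono : ∀ k, k ≤ d → ∀ σ σ' : ℕ → V, (∀ j, j < k → σ j ≤ σ' j) → ψ k σ ≤ ψ k σ'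
  fix : ∀ m k, m ≤ k → k ≤ d → ∀ σ, ψ k (fillS m σ (ψ m σ)) = ψ m σ
  last : ∀ σ, ψ d σ = δ (fun i => σ i.val)

theorem PsiFam.congr {V : Type*} [PartialOrder V] {d : ℕ} {δ : (Fin d → V) → V}
    {ψ : ℕ → (ℕ → V) → V} (h : PsiFam δ ψ) {k : ℕ} (hk : k ≤ d) {σ σ' : ℕ → V}
    (hs : ∀ j, j < k → σ j = σ' j) : ψ k σ = ψ k σ' :=
  le_antisymm (h.mono k hk _ _ fun j hj => (hs j hj).le)
    (h.mono k hk _ _ fun j hj => (hs j hj).ge)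

theorem PsiFam.dual {V : Type*} [PartialOrder V] {d : ℕ} {δ : (Fin d → V) → V}
    {ψ : ℕ → (ℕ → V) → V} (h : PsiFam δ ψ) :
    PsiFam (V := Vᵒᵈ) (d := d) δ ψ where
  dmono := fun a b hab => by
    have key : ∀ x y : Fin d → V, (∀ i, x i ≤ y i) → δ x ≤ δ y := fun x y hxy => h.dmono hxy
    exact key b a fun i => hab i
  mono := fun k hk σ σ' hs => h.mono k hk σ' σ hs
  fix := h.fix
  last := h.last

theorem up_core {V : Type*} [CompleteLattice V] {d m : ℕ} (hm : m < d)
    {δ : (Fin d → V) → V} {ψ : ℕ → (ℕ → V) → V} (h : PsiFam δ ψ) (σ : ℕ → V)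
    (sat : ∀ i, i < m → σ i = δ (fun j : Fin d => σ (min i j.val))) (v : V)
    (hv : UpOK d ψ m σ v) :
    ∃ u, v ≤ u ∧ u = δ (tupS d m σ u) ∧ UpOK d ψ m σ u ∧ u ≤ ψ (m+1) (fillS m σ u) ∧
      UpOK d ψ m σ (ψ (m+1) (fillS m σ u)) ∧
      IsLeast {z : Fin d → V | (fun i => δ (fun j => z (min i j))) = z ∧ tupS d m σ v ≤ z}
        (tupS d m σ u) := by
  have fmono : ∀ {x y : V}, x ≤ y → ∀ j, fillS m σ x j ≤ fillS m σ y j := by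
    intro x y hxy j
    unfold fillS
    split_ifs
    · exact le_rfl
    · exact hxy
  have gmono : ∀ {x y : V}, x ≤ y → δ (tupS d m σ x) ≤ δ (tupS d m σ y) := by
    intro x y hxy
    exact h.dmono fun i => fmono hxy _
  have hvg : v ≤ δ (tupS d m σ v) := by
    have := hv d hm.le le_rfl
    rwa [h.last] at this
  obtain ⟨u, hu⟩ : ∃ u, u = sInf {x | v ≤ x ∧ δ (tupS d m σ x) ≤ x} := ⟨_, rfl⟩
  have hleast : ∀ x, v ≤ x → δ (tupS d m σ x) ≤ x → u ≤ x := by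
    intro x h1 h2
    rw [hu]
    exact sInf_le ⟨h1, h2⟩
  have hvu : v ≤ u := by
    rw [hu]
    exact le_sInf fun x hx => hx.1
  have hgu : δ (tupS d m σ u) ≤ u := by
    conv_rhs => rw [hu]
    refine le_sInf fun x hx => le_trans (gmono (hleast x hx.1 hx.2)) hx.2
  have hug : u = δ (tupS d m σ u) :=
    le_antisymm (hleast _ (hvg.trans (gmono hvu)) (gmono hgu)) hgu
  have huA : UpOK d ψ m σ u := by
    intro k hmk hkd
    obtain ⟨w, hw⟩ : ∃ w, w = ψ k (fillS m σ u) := ⟨_, rfl⟩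
    rw [← hw]
    have hvw : v ≤ w := by
      rw [hw]
      exact (hv k hmk hkd).trans (h.mono k hkd _ _ fun j _ => fmono hvu j)
    have hfw : δ (fun i : Fin d => fillS k (fillS m σ u) w i.val) = w := by
      have := h.fix k d hkd le_rfl (fillS m σ u)
      rw [h.last, ← hw] at this
      exact this
    have : u ≤ u ⊓ w := by
      refine hleast _ (le_inf hvu hvw) (le_inf ((gmono inf_le_left).trans hgu) ?_)
      conv_rhs => rw [← hfw]
      refine h.dmono fun i => ?_
      simp only [tupS, fillS]
      split_ifs <;> first | exact le_rfl | exact inf_le_left | exact inf_le_right | omega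
    exact this.trans inf_le_right
  have huw : u ≤ ψ (m+1) (fillS m σ u) := huA (m+1) (by omega) (by omega)
  refine ⟨u, hvu, hug, huA, huw, ?_, ?_, ?_⟩
  · obtain ⟨w, hw⟩ : ∃ w, w = ψ (m+1) (fillS m σ u) := ⟨_, rfl⟩
    rw [← hw] at huw ⊢
    intro k hmk hkd
    rcases Nat.eq_or_lt_of_le hmk with rfl | hlt
    · have e1 : ∀ x, ψ m (fillS m σ x) = ψ m σ := fun x =>
        h.congr hkd fun j hj => by simp [fillS, hj]
      have huM : u ≤ ψ m σ := by
        have := huA m le_rfl hkd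
        rwa [e1] at this
      rw [e1, hw, ← h.fix m (m+1) (by omega) hm σ]
      rw [h.fix m (m+1) (by omega) hm σ]
      calc ψ (m+1) (fillS m σ u) ≤ ψ (m+1) (fillS m σ (ψ m σ)) :=
            h.mono _ hm _ _ fun j _ => fmono huM j
        _ = ψ m σ := h.fix m (m+1) (by omega) hm σ
    · have := h.fix (m+1) k hlt hkd (fillS m σ u)
      rw [← hw] at this
      conv_lhs => rw [← this]
      refine h.mono k hkd _ _ fun j _ => ?_
      simp only [fillS]
      split_ifs <;> first | exact le_rfl | exact huw | omega
  · refine ⟨?_, fun i => fmono hvu _⟩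
    funext i
    by_cases hi : i.val < m
    · simp only [tupS, fillS, hi, if_true]
      rw [sat i.val hi]
      congr 1
      funext j
      have : (min i j).val = min i.val j.val := by
        rcases le_total i j with hij | hij
        · rw [min_eq_left hij, min_eq_left (Fin.le_def.mp hij)]
        · rw [min_eq_right hij, min_eq_right (Fin.le_def.mp hij)]
      rw [this, if_pos (by omega)]
    · have e : tupS d m σ u i = u := by simp [tupS, fillS, hi]
      rw [e]
      conv_rhs => rw [hug]
      congr 1
      funext j
      rcases le_total i j with hij | hij
      · have := Fin.le_def.mp hij
        rw [min_eq_left hij, e]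
        simp [tupS, fillS, show ¬ j.val < m by omega]
      · rw [min_eq_right hij]
  · rintro z ⟨hz, hvz⟩
    have hpre : ∀ i : Fin d, i.val < m → σ i.val ≤ z i := by
      intro i hi
      have := hvz i
      simpa [tupS, fillS, hi] using this
    obtain ⟨x, hx⟩ : ∃ x, x = u ⊓ ⨅ i : {i : Fin d // m ≤ i.val}, z i.1 := ⟨_, rfl⟩
    have hxz : ∀ i : Fin d, m ≤ i.val → x ≤ z i := by
      intro i hi
      rw [hx]
      exact inf_le_right.trans (iInf_le (fun i : {i : Fin d // m ≤ i.val} => z i.1) ⟨i, hi⟩)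
    have hux : u ≤ x := by
      refine hleast x ?_ ?_
      · rw [hx]
        refine le_inf hvu (le_iInf fun i => ?_)
        have := hvz i.1
        simpa [tupS, fillS, show ¬ i.1.val < m by have := i.2; omega] using this
      · conv_rhs => rw [hx]
        refine le_inf ?_ (le_iInf fun i => ?_)
        · refine (gmono ?_).trans hgu
          rw [hx]
          exact inf_le_left
        · rw [← hz]
          refine h.dmono fun j => ?_
          have hi := i.2
          rcases le_total i.1 j with hij | hij
          · have := Fin.le_def.mp hij
            rw [min_eq_left hij]
            simp only [tupS, fillS, show ¬ j.val < m by omega, if_false]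
            exact hxz _ hi
          · rw [min_eq_right hij]
            simp only [tupS, fillS]
            split_ifs with hj
            · exact hpre j hj
            · exact hxz j (by omega)
    intro i
    simp only [tupS, fillS]
    split_ifs with hi
    · exact hpre i hi
    · exact hux.trans (hxz i (by omega))

theorem up_step {V : Type*} [CompleteLattice V] {d m : ℕ} (hm : m < d)
    {δ : (Fin d → V) → V} {ψ : ℕ → (ℕ → V) → V} (h : PsiFam δ ψ) (σ : ℕ → V)
    (H4 : ∀ v, ψ (m+1) (fillS m σ v) ≤ v → ψ m σ ≤ v)
    (F : PFunc (Fin d → V)) (hFm : MonotonePF F)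
    (hF : ∀ v, UpOK d ψ m σ v → ∃ u, v ≤ u ∧ u ≤ ψ (m+1) (fillS m σ u) ∧
      UpOK d ψ m σ (ψ (m+1) (fillS m σ u)) ∧ tupS d m σ v ∈ F.dom ∧
      F.toFun (tupS d m σ v) = tupS d m σ (ψ (m+1) (fillS m σ u)))
    (v : V) (hv : UpOK d ψ m σ v) :
    IsLeast {z | z ∈ F.Fix ∧ tupS d m σ v ≤ z} (tupS d m σ (ψ m σ)) := by
  have fmono : ∀ {x y : V}, x ≤ y → ∀ j, fillS m σ x j ≤ fillS m σ y j := by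
    intro x y hxy j
    unfold fillS
    split_ifs
    · exact le_rfl
    · exact hxy
  have leM : ∀ x, UpOK d ψ m σ x → x ≤ ψ m σ := by
    intro x hx
    have := hx m le_rfl hm.le
    rwa [h.congr hm.le (σ' := σ) fun j hj => by simp [fillS, hj]] at this
  have hMA : UpOK d ψ m σ (ψ m σ) := fun k h1 h2 => (h.fix m k h1 h2 σ).ge
  refine ⟨⟨?_, fun i => fmono (leM v hv) _⟩, ?_⟩
  · obtain ⟨u, h1, h2, h3, h4, h5⟩ := hF _ hMA
    have e : ψ (m+1) (fillS m σ u) = ψ m σ := le_antisymm (leM _ h3) (h1.trans h2)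
    rw [e] at h5
    exact ⟨h4, h5⟩
  · rintro z ⟨hzF, hvz⟩
    obtain ⟨B, hB⟩ : ∃ B : Set V, B = {x | v ≤ x ∧ UpOK d ψ m σ x ∧ tupS d m σ x ≤ z} :=
      ⟨_, rfl⟩
    have hvB : v ∈ B := by
      rw [hB]
      exact ⟨le_rfl, hv, hvz⟩
    have hsB : sSup B ∈ B := by
      have key : ∀ x ∈ B, x ≤ sSup B := fun x hx => le_sSup hx
      have hB' : ∀ x ∈ B, UpOK d ψ m σ x ∧ tupS d m σ x ≤ z := by
        intro x hx
        rw [hB] at hx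
        exact hx.2
      have : v ≤ sSup B ∧ UpOK d ψ m σ (sSup B) ∧ tupS d m σ (sSup B) ≤ z := by
        refine ⟨key v hvB, fun k h1 h2 => sSup_le fun x hx => ?_, fun i => ?_⟩
        · exact ((hB' x hx).1 k h1 h2).trans (h.mono k h2 _ _ fun j _ => fmono (key x hx) j)
        · by_cases hi : i.val < m
          · have := hvz i
            simpa [tupS, fillS, hi] using this
          · have e : tupS d m σ (sSup B) i = sSup B := by simp [tupS, fillS, hi]
            rw [e]
            refine sSup_le fun x hx => ?_
            have := (hB' x hx).2 i
            simpa [tupS, fillS, hi] using this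
      rw [hB] at this ⊢
      exact this
    obtain ⟨s, hs⟩ : ∃ s, s = sSup B := ⟨_, rfl⟩
    have hsmax : ∀ x ∈ B, x ≤ s := fun x hx => by
      rw [hs]
      exact le_sSup hx
    rw [← hs] at hsB
    have hsB' := hsB
    rw [hB] at hsB'
    obtain ⟨h1, h2, h3⟩ := hsB'
    obtain ⟨u, g1, g2, g3, g4, g5⟩ := hF s h2
    have hw : ψ (m+1) (fillS m σ u) ∈ B := by
      rw [hB]
      refine ⟨h1.trans (g1.trans g2), g3, ?_⟩
      have := hFm _ g4 _ hzF.1 h3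
      rwa [g5, hzF.2] at this
    have hle := hsmax _ hw
    have hM : ψ m σ ≤ s :=
      H4 s ((h.mono (m+1) hm _ _ fun j _ => fmono g1 j).trans hle)
    exact le_trans (fun i => fmono hM _) h3

theorem limUp_of {X : Type*} [PartialOrder X] {F : PFunc X} {x y : X}
    (h : IsLeast {z | z ∈ F.Fix ∧ x ≤ z} y) :
    x ∈ (limUp F).dom ∧ (limUp F).toFun x = y := by
  have hex : ∃ y, IsLeast {z | z ∈ F.Fix ∧ x ≤ z} y := ⟨y, h⟩
  refine ⟨hex, ?_⟩
  simp only [limUp]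
  rw [dif_pos hex]
  exact hex.choose_spec.unique h

theorem limDown_of {X : Type*} [PartialOrder X] {F : PFunc X} {x y : X}
    (h : IsGreatest {z | z ∈ F.Fix ∧ z ≤ x} y) :
    x ∈ (limDown F).dom ∧ (limDown F).toFun x = y := by
  have hex : ∃ y, IsGreatest {z | z ∈ F.Fix ∧ z ≤ x} y := ⟨y, h⟩
  refine ⟨hex, ?_⟩
  simp only [limDown]
  rw [dif_pos hex]
  exact hex.choose_spec.unique h

theorem limUp_mono {X : Type*} [PartialOrder X] (F : PFunc X) : MonotonePF (limUp F) := by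
  rintro x ⟨a, ha⟩ y ⟨b, hb⟩ hxy
  rw [(limUp_of ha).2, (limUp_of hb).2]
  exact ha.2 ⟨hb.1.1, hxy.trans hb.1.2⟩

theorem limDown_mono {X : Type*} [PartialOrder X] (F : PFunc X) : MonotonePF (limDown F) := by
  rintro x ⟨a, ha⟩ y ⟨b, hb⟩ hxy
  rw [(limDown_of ha).2, (limDown_of hb).2]
  exact hb.2 ⟨ha.1.1, ha.1.2.trans hxy⟩

theorem comp_mono {X : Type*} [PartialOrder X] {F G : PFunc X} (hF : MonotonePF F)
    (hG : MonotonePF G) : MonotonePF (F.comp G) :=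
  fun x hx y hy hxy => hG _ hx.2 _ hy.2 (hF _ hx.1 _ hy.1 hxy)

theorem Bid_mono {V : Type*} [CompleteLattice V] {d : ℕ} (n : ℕ) :
    MonotonePF (PFunc.total (Bid (V := V) (d := d) n)) := by
  intro x _ y _ hxy i
  simp only [PFunc.total, Bid]
  split_ifs <;> first | exact le_rfl | exact hxy _

theorem Cut_mono {V : Type*} [CompleteLattice V] {d : ℕ} (n : ℕ) :
    MonotonePF (PFunc.total (Cut (V := V) (d := d) n)) := by
  intro x _ y _ hxy i
  simp only [PFunc.total, Cut]
  split_ifs <;> first | exact le_rfl | exact hxy _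

theorem PhiAux_mono {V : Type*} [CompleteLattice V] {d : ℕ} (δ : (Fin d → V) → V) (k : ℕ) :
    MonotonePF (PhiAux δ k) := by
  cases k with
  | zero => exact comp_mono (Bid_mono _) (limDown_mono _)
  | succ k =>
    rw [PhiAux]
    split_ifs
    · exact comp_mono (Bid_mono _) (limUp_mono _)
    · exact comp_mono (Bid_mono _) (limDown_mono _)

theorem lfpOf_fix {V : Type*} [CompleteLattice V] {f : V → V} (hf : Monotone f) :
    f (lfpOf f) = lfpOf f := OrderHom.map_lfp ⟨f, hf⟩

theorem gfpOf_fix {V : Type*} [CompleteLattice V] {f : V → V} (hf : Monotone f) :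
    f (gfpOf f) = gfpOf f := OrderHom.map_gfp ⟨f, hf⟩

/-- `psi δ m σ = ψ_{m+1}(σ)`. -/
noncomputable def psi {V : Type*} [CompleteLattice V] {d : ℕ} (δ : (Fin d → V) → V)
    (m : ℕ) (σ : ℕ → V) : V := NestedAux δ (d - m) σ

theorem psi_mono {V : Type*} [CompleteLattice V] {d : ℕ} {δ : (Fin d → V) → V}
    (hδ : Monotone δ) (k : ℕ) : k ≤ d → ∀ σ σ' : ℕ → V, (∀ j, j < d - k → σ j ≤ σ' j) →
    NestedAux δ k σ ≤ NestedAux δ k σ' := by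
  induction k with
  | zero => exact fun _ σ σ' hs => hδ fun i => hs _ (by omega)
  | succ k ih =>
    intro hk σ σ' hs
    have key : ∀ y, NestedAux δ k (fun j => if j = d - k - 1 then y else σ j) ≤
        NestedAux δ k (fun j => if j = d - k - 1 then y else σ' j) := by
      intro y
      refine ih (by omega) _ _ fun j hj => ?_
      split_ifs
      · exact le_rfl
      · exact hs j (by omega)
    simp only [NestedAux]
    split_ifs
    · exact sInf_le_sInf fun x hx => (key x).trans hx
    · exact sSup_le_sSup fun x hx => le_trans hx (key x)

theorem psi_unfold {V : Type*} [CompleteLattice V] {d : ℕ} {δ : (Fin d → V) → V}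
    (hδ : Monotone δ) {m : ℕ} (hm : m < d) (σ : ℕ → V) :
    psi δ m σ = if Even m then lfpOf (fun y => psi δ (m+1) (fillS m σ y))
      else gfpOf (fun y => psi δ (m+1) (fillS m σ y)) := by
  have e : d - m = (d - (m+1)) + 1 := by omega
  have e2 : d - (d - (m+1)) = m + 1 := by omega
  have key : ∀ y, NestedAux δ (d - (m+1)) (fun j => if j = m then y else σ j) =
      NestedAux δ (d - (m+1)) (fillS m σ y) := by
    intro y
    apply le_antisymm <;> refine psi_mono hδ _ (by omega) _ _ fun j hj => ?_ <;>
      simp only [fillS] <;> split_ifs <;> first | exact le_rfl | omega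
  simp only [psi]
  rw [e]
  simp only [NestedAux, e2, Nat.add_sub_cancel, key]
  by_cases h : Even m
  · rw [if_pos h, if_pos h.add_one]
  · rw [if_neg h, if_neg (by rw [Nat.not_odd_iff_even]; exact (Nat.not_even_iff_odd.mp h).add_one)]

theorem fill_mono {V : Type*} [CompleteLattice V] {d : ℕ} {δ : (Fin d → V) → V}
    (hδ : Monotone δ) {m : ℕ} (hm : m < d) (σ : ℕ → V) :
    Monotone (fun y => psi δ (m+1) (fillS m σ y)) := by
  intro x y hxy
  refine psi_mono hδ _ (by omega) _ _ fun j hj => ?_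
  simp only [fillS]
  split_ifs
  · exact le_rfl
  · exact hxy

theorem psi_fam {V : Type*} [CompleteLattice V] {d : ℕ} {δ : (Fin d → V) → V}
    (hδ : Monotone δ) : PsiFam δ (psi δ) where
  dmono := hδ
  mono := fun k hk σ σ' hs => psi_mono hδ _ (by omega) _ _ fun j hj => hs j (by omega)
  last := fun σ => by simp [psi, NestedAux]
  fix := by
    intro m k hmk
    induction k, hmk using Nat.le_induction with
    | base =>
      intro hk σ
      apply le_antisymm <;> refine psi_mono hδ _ (by omega) _ _ fun j hj => ?_ <;>
        simp only [fillS] <;> split_ifs <;> first | exact le_rfl | omega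
    | succ k hmk ih =>
      intro hk σ
      obtain ⟨w, hw⟩ : ∃ w, w = psi δ m σ := ⟨_, rfl⟩
      have ih' := ih (by omega) σ
      rw [← hw] at ih' ⊢
      have hfix : psi δ (k+1) (fillS k (fillS m σ w) (psi δ k (fillS m σ w))) =
          psi δ k (fillS m σ w) := by
        rw [psi_unfold hδ (by omega : k < d) (fillS m σ w)]
        split_ifs
        · exact lfpOf_fix (fill_mono hδ (by omega) _)
        · exact gfpOf_fix (fill_mono hδ (by omega) _)
      rw [ih'] at hfix
      have e : fillS k (fillS m σ w) w = fillS m σ w := by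
        funext j
        simp only [fillS]
        split_ifs <;> first | rfl | omega
      rwa [e] at hfix

theorem psi_lfp {V : Type*} [CompleteLattice V] {d : ℕ} {δ : (Fin d → V) → V}
    (hδ : Monotone δ) {m : ℕ} (hm : m < d) (he : Even m) (σ : ℕ → V) (v : V)
    (hv : psi δ (m+1) (fillS m σ v) ≤ v) : psi δ m σ ≤ v := by
  rw [psi_unfold hδ hm, if_pos he]
  exact sInf_le hv

theorem psi_gfp {V : Type*} [CompleteLattice V] {d : ℕ} {δ : (Fin d → V) → V}
    (hδ : Monotone δ) {m : ℕ} (hm : m < d) (he : ¬ Even m) (σ : ℕ → V) (v : V)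
    (hv : v ≤ psi δ (m+1) (fillS m σ v)) : v ≤ psi δ m σ := by
  rw [psi_unfold hδ hm, if_neg he]
  exact le_sSup hv

/-- Dual of `up_core`. -/
theorem dn_core {V : Type*} [CompleteLattice V] {d m : ℕ} (hm : m < d)
    {δ : (Fin d → V) → V} {ψ : ℕ → (ℕ → V) → V} (h : PsiFam δ ψ) (σ : ℕ → V)
    (sat : ∀ i, i < m → σ i = δ (fun j : Fin d => σ (min i j.val))) (v : V)
    (hv : DnOK d ψ m σ v) :
    ∃ u, u ≤ v ∧ u = δ (tupS d m σ u) ∧ DnOK d ψ m σ u ∧ ψ (m+1) (fillS m σ u) ≤ u ∧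
      DnOK d ψ m σ (ψ (m+1) (fillS m σ u)) ∧
      IsGreatest {z : Fin d → V | (fun i => δ (fun j => z (min i j))) = z ∧ z ≤ tupS d m σ v}
        (tupS d m σ u) :=
  up_core (V := Vᵒᵈ) hm h.dual σ sat v hv

/-- Dual of `up_step`. -/
theorem dn_step {V : Type*} [CompleteLattice V] {d m : ℕ} (hm : m < d)
    {δ : (Fin d → V) → V} {ψ : ℕ → (ℕ → V) → V} (h : PsiFam δ ψ) (σ : ℕ → V)
    (H4 : ∀ v, v ≤ ψ (m+1) (fillS m σ v) → v ≤ ψ m σ)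
    (F : PFunc (Fin d → V)) (hFm : MonotonePF F)
    (hF : ∀ v, DnOK d ψ m σ v → ∃ u, u ≤ v ∧ ψ (m+1) (fillS m σ u) ≤ u ∧
      DnOK d ψ m σ (ψ (m+1) (fillS m σ u)) ∧ tupS d m σ v ∈ F.dom ∧
      F.toFun (tupS d m σ v) = tupS d m σ (ψ (m+1) (fillS m σ u)))
    (v : V) (hv : DnOK d ψ m σ v) :
    IsGreatest {z | z ∈ F.Fix ∧ z ≤ tupS d m σ v} (tupS d m σ (ψ m σ)) :=
  up_step (V := Vᵒᵈ) hm h.dual σ H4 F (fun x hx y hy hxy => hFm y hy x hx hxy) hF v hv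

/-- Invariant for prefixes of length `m`. -/
structure GoodPre {V : Type*} [CompleteLattice V] {d : ℕ} (δ : (Fin d → V) → V) (m : ℕ)
    (σ : ℕ → V) : Prop where
  sat : ∀ i, i < m → σ i = δ (fun j : Fin d => σ (min i j.val))
  up : ∀ i, i < m → Even i → UpOK d (psi δ) i σ (σ i)
  dn : ∀ i, i < m → ¬ Even i → DnOK d (psi δ) i σ (σ i)

/-- The start value of the loop. -/
def startV {V : Type*} [CompleteLattice V] (m : ℕ) (σ : ℕ → V) : V :=
  if m = 0 then ⊥ else if m = 1 then ⊤ else σ (m - 2)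

theorem Bid_eq {V : Type*} [CompleteLattice V] {d m : ℕ} (hm : m < d) (σ : ℕ → V)
    (τ : Fin d → V) (hτ : ∀ i : Fin d, i.val < m → τ i = σ i.val) :
    Bid (m+1) τ = tupS d m σ (startV m σ) := by
  funext i
  simp only [Bid, tupS, fillS, startV]
  by_cases hi : i.val < m
  · rw [if_pos (by omega), if_pos hi, hτ i hi]
  · rw [if_neg (by omega), if_neg hi]
    by_cases h0 : m = 0
    · simp [h0]
    · by_cases h1 : m = 1
      · simp [h1]
      · rw [if_neg (by omega), if_neg (by omega), dif_pos (by omega), if_neg h0, if_neg h1]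
        rw [hτ _ (by simp; omega)]
        congr 1

theorem good_next {V : Type*} [CompleteLattice V] {d m : ℕ} (hm : m < d)
    {δ : (Fin d → V) → V} {σ : ℕ → V}
    (g : GoodPre δ m σ) (u : V) (hu : u = δ (tupS d m σ u))
    (h1 : Even m → UpOK d (psi δ) m σ u) (h2 : ¬ Even m → DnOK d (psi δ) m σ u) :
    GoodPre δ (m+1) (fillS m σ u) := by
  have e1 : ∀ i, i < m → fillS m σ u i = σ i := fun i hi => by simp [fillS, hi]
  have e2 : fillS m σ u m = u := by simp [fillS]
  have e3 : ∀ i, i ≤ m → ∀ v, fillS i (fillS m σ u) v = fillS i σ v := by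
    intro i hi v
    funext j
    simp only [fillS]
    split_ifs <;> first | rfl | omega
  refine ⟨?_, ?_, ?_⟩
  · intro i hi
    rcases Nat.lt_succ_iff_lt_or_eq.mp hi with hlt | rfl
    · rw [e1 i hlt, g.sat i hlt]
      congr 1
      funext j
      rw [e1 _ (by omega)]
    · rw [e2]
      conv_lhs => rw [hu]
      congr 1
      funext j
      simp only [tupS, fillS]
      split_ifs <;> first | rfl | omega | (congr 1; omega)
  · intro i hi he
    intro k hk hkd
    rw [e3 i (by omega)]
    rcases Nat.lt_succ_iff_lt_or_eq.mp hi with hlt | rfl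
    · rw [e1 i hlt]
      exact g.up i hlt he k hk hkd
    · rw [e2]
      exact h1 he k hk hkd
  · intro i hi he
    intro k hk hkd
    rw [e3 i (by omega)]
    rcases Nat.lt_succ_iff_lt_or_eq.mp hi with hlt | rfl
    · rw [e1 i hlt]
      exact g.dn i hlt he k hk hkd
    · rw [e2]
      exact h2 he k hk hkd

theorem start_up {V : Type*} [CompleteLattice V] {d m : ℕ} (hm : m < d)
    {δ : (Fin d → V) → V} (hδ : Monotone δ) {σ : ℕ → V}
    (g : GoodPre δ m σ) (he : Even m) : UpOK d (psi δ) m σ (startV m σ) := by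
  intro k hk hkd
  unfold startV
  by_cases h0 : m = 0
  · rw [if_pos h0]
    exact bot_le
  · have h1 : m ≠ 1 := by
      rintro rfl
      simp at he
    rw [if_neg h0, if_neg h1]
    have he2 : Even (m - 2) := (Nat.even_sub (by omega)).2 (by simp [he])
    have ho1 : ¬ Even (m - 1) := fun hh =>
      absurd ((Nat.even_sub (by omega : 1 ≤ m)).1 hh |>.1 he) (by decide)
    have a := g.up (m-2) (by omega) he2
    have b := g.dn (m-1) (by omega) ho1
    have hab : σ (m-2) ≤ σ (m-1) := by
      refine (a (m-1) (by omega) (by omega)).trans (le_trans ?_ (b (m-1) le_rfl (by omega)))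
      refine (psi_fam hδ).mono _ (by omega) _ _ fun j hj => ?_
      simp only [fillS]
      split_ifs <;> first | exact le_rfl | omega | (have : j = m - 2 := by omega); rw [this]
    refine (a k (by omega) hkd).trans ?_
    refine (psi_fam hδ).mono _ hkd _ _ fun j hj => ?_
    simp only [fillS]
    split_ifs with c1 c2 c2
    · exact le_rfl
    · omega
    · rcases (by omega : j = m - 2 ∨ j = m - 1) with r | r <;> rw [r]
      exact hab
    · exact le_rfl

theorem start_dn {V : Type*} [CompleteLattice V] {d m : ℕ} (hm : m < d)
    {δ : (Fin d → V) → V} (hδ : Monotone δ) {σ : ℕ → V}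
    (g : GoodPre δ m σ) (he : ¬ Even m) : DnOK d (psi δ) m σ (startV m σ) := by
  intro k hk hkd
  unfold startV
  have h0 : m ≠ 0 := by
    rintro rfl
    simp at he
  by_cases h1 : m = 1
  · rw [if_neg h0, if_pos h1]
    exact le_top
  · rw [if_neg h0, if_neg h1]
    have he2 : ¬ Even (m - 2) := fun hh =>
      he ((Nat.even_sub (by omega : 2 ≤ m)).1 hh |>.2 (by decide))
    have ho1 : Even (m - 1) := (Nat.even_sub (by omega)).2 (by simp [he])
    have a := g.dn (m-2) (by omega) he2
    have b := g.up (m-1) (by omega) ho1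
    have hab : σ (m-1) ≤ σ (m-2) := by
      refine le_trans (b (m-1) le_rfl (by omega)) (le_trans ?_ (a (m-1) (by omega) (by omega)))
      refine (psi_fam hδ).mono _ (by omega) _ _ fun j hj => ?_
      simp only [fillS]
      split_ifs <;> first | exact le_rfl | omega | (have : j = m - 2 := by omega); rw [this]
    refine le_trans ?_ (a k (by omega) hkd)
    refine (psi_fam hδ).mono _ hkd _ _ fun j hj => ?_
    simp only [fillS]
    split_ifs with c1 c2 c2
    · exact le_rfl
    · rcases (by omega : j = m - 2 ∨ j = m - 1) with r | r <;> rw [r]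
      exact hab
    · omega
    · exact le_rfl

theorem Cut_eq {V : Type*} [CompleteLattice V] {d m : ℕ} (hm : m + 1 < d) (σ : ℕ → V) (u w : V) :
    Cut (m+1) (tupS d (m+1) (fillS m σ u) w) = tupS d m σ w := by
  funext i
  simp only [Cut, tupS, fillS]
  split_ifs <;> first | rfl | omega

theorem Phi_main {V : Type*} [CompleteLattice V] {d : ℕ} (hde : Even d)
    {δ : (Fin d → V) → V} (hδ : Monotone δ) (k : ℕ) :
    ∀ m, m + k + 1 = d → ∀ σ : ℕ → V, GoodPre δ m σ → ∀ τ : Fin d → V,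
      (∀ i : Fin d, i.val < m → τ i = σ i.val) →
      τ ∈ (PhiAux δ k).dom ∧ (PhiAux δ k).toFun τ = tupS d m σ (psi δ m σ) := by
  have hP := psi_fam hδ
  induction k with
  | zero =>
    intro m hmk σ g τ hτ
    have hm : m < d := by omega
    have ho : ¬ Even m := by
      intro hh
      have : Odd d := by
        rw [← hmk]
        exact hh.add_one
      exact (Nat.not_even_iff_odd.mpr this) hde
    obtain ⟨u, u1, u2, u3, u4, u5, u6⟩ := dn_core hm hP σ g.sat _ (start_dn hm hδ g ho)
    have eu : u = psi δ m σ := by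
      apply le_antisymm
      · apply psi_gfp hδ hm ho
        have : m + 1 = d := by omega
        rw [this, hP.last]
        exact u2.le
      · have := u3 m le_rfl hm.le
        rwa [hP.congr hm.le (σ' := σ) fun j hj => by simp [fillS, hj]] at this
    rw [eu] at u6
    have hB := Bid_eq hm σ τ hτ
    have hmd : m + 1 = d := by omega
    rw [hmd] at hB
    have hl : IsGreatest {z | z ∈ (PFunc.total (Delta δ)).Fix ∧ z ≤ Bid d τ}
        (tupS d m σ (psi δ m σ)) := by
      rw [hB]
      exact ⟨⟨⟨trivial, u6.1.1⟩, u6.1.2⟩, fun z hz => u6.2 ⟨hz.1.2, hz.2⟩⟩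
    obtain ⟨l1, l2⟩ := limDown_of hl
    exact ⟨⟨trivial, l1⟩, l2⟩
  | succ k ih =>
    intro m hmk σ g τ hτ
    have hm : m < d := by omega
    have hn : d - (k+1) = m + 1 := by omega
    have hB := Bid_eq hm σ τ hτ
    rw [PhiAux, hn]
    by_cases he : Even m
    · rw [if_pos he.add_one]
      obtain ⟨F, hFdef⟩ : ∃ F, F = ((limUp (PFunc.total (Delta δ))).comp (PhiAux δ k)).comp
            (PFunc.total (Cut (m+1))) := ⟨_, rfl⟩
      rw [← hFdef]
      have hFm : MonotonePF F := by
        rw [hFdef]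
        exact comp_mono (comp_mono (limUp_mono _) (PhiAux_mono _ _)) (Cut_mono _)
      have hl := up_step hm hP σ (psi_lfp hδ hm he σ) F hFm (by
        intro v hv
        obtain ⟨u, u1, u2, u3, u4, u5, u6⟩ := up_core hm hP σ g.sat v hv
        refine ⟨u, u1, u4, u5, ?_⟩
        have hl : IsLeast {z | z ∈ (PFunc.total (Delta δ)).Fix ∧ tupS d m σ v ≤ z}
            (tupS d m σ u) :=
          ⟨⟨⟨trivial, u6.1.1⟩, u6.1.2⟩, fun z hz => u6.2 ⟨hz.1.2, hz.2⟩⟩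
        obtain ⟨l1, l2⟩ := limUp_of hl
        obtain ⟨p1, p2⟩ := ih (m+1) (by omega) (fillS m σ u)
          (good_next hm g u u2 (fun _ => u3) (fun h => absurd he h)) (tupS d m σ u)
          (fun i _ => rfl)
        rw [hFdef]
        simp only [PFunc.comp, PFunc.total] at l1 l2 ⊢
        refine ⟨⟨⟨l1, ?_⟩, trivial⟩, ?_⟩
        · rw [l2]
          exact p1
        · rw [l2, p2]
          exact Cut_eq (by omega) σ u _) _ (start_up hm hδ g he)
      rw [← hB] at hl
      obtain ⟨l1, l2⟩ := limUp_of hl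
      exact ⟨⟨trivial, l1⟩, l2⟩
    · rw [if_neg (by
        rw [Nat.not_odd_iff_even]
        exact (Nat.not_even_iff_odd.mp he).add_one)]
      obtain ⟨F, hFdef⟩ : ∃ F, F = ((limDown (PFunc.total (Delta δ))).comp (PhiAux δ k)).comp
            (PFunc.total (Cut (m+1))) := ⟨_, rfl⟩
      rw [← hFdef]
      have hFm : MonotonePF F := by
        rw [hFdef]
        exact comp_mono (comp_mono (limDown_mono _) (PhiAux_mono _ _)) (Cut_mono _)
      have hl := dn_step hm hP σ (psi_gfp hδ hm he σ) F hFm (by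
        intro v hv
        obtain ⟨u, u1, u2, u3, u4, u5, u6⟩ := dn_core hm hP σ g.sat v hv
        refine ⟨u, u1, u4, u5, ?_⟩
        have hl : IsGreatest {z | z ∈ (PFunc.total (Delta δ)).Fix ∧ z ≤ tupS d m σ v}
            (tupS d m σ u) :=
          ⟨⟨⟨trivial, u6.1.1⟩, u6.1.2⟩, fun z hz => u6.2 ⟨hz.1.2, hz.2⟩⟩
        obtain ⟨l1, l2⟩ := limDown_of hl
        obtain ⟨p1, p2⟩ := ih (m+1) (by omega) (fillS m σ u)
          (good_next hm g u u2 (fun h => absurd h he) (fun _ => u3)) (tupS d m σ u)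
          (fun i _ => rfl)
        rw [hFdef]
        simp only [PFunc.comp, PFunc.total] at l1 l2 ⊢
        refine ⟨⟨⟨l1, ?_⟩, trivial⟩, ?_⟩
        · rw [l2]
          exact p1
        · rw [l2, p2]
          exact Cut_eq (by omega) σ u _) _ (start_dn hm hδ g he)
      rw [← hB] at hl
      obtain ⟨l1, l2⟩ := limDown_of hl
      exact ⟨⟨trivial, l1⟩, l2⟩

/-- Let `⊥̄ = (⊥,…,⊥) ∈ V^d`. Then the first coordinate of
`Φ₁(⊥̄)` equals the alternating nested fixed point
`μx₁.νx₂.μx₃.νx₄.⋯.μx_{d−1}.νx_d.δ(x₁,…,x_d)`. -/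
theorem stmt17 {V : Type*} [CompleteLattice V] {d : ℕ} (hd : 1 ≤ d) (hde : Even d)
    (δ : (Fin d → V) → V) (hmono : Monotone δ) (hcont : ChainContinuous δ) :
    (Phi δ 1).toFun (fun _ => (⊥ : V)) ⟨0, by omega⟩ = Nested δ := by
  have g : GoodPre δ 0 (fun _ => (⊥ : V)) :=
    ⟨fun i hi => absurd hi (by omega), fun i hi => absurd hi (by omega),
      fun i hi => absurd hi (by omega)⟩
  have h := (Phi_main hde hmono (d - 1) 0 (by omega) _ g (fun _ => ⊥) (fun _ _ => rfl)).2
  have h2 := congrFun h ⟨0, by omega⟩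
  simpa [Phi, Nested, tupS, fillS, psi] using h2
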